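/- Let M ≥ 2, K > 0 real, and u₁, …, u_M ∈ ℂ with Re(u_m) < 0 for m = 2, …, M and Σ_{m=1}^M Re(u_m) > 1. Then the bilateral Laplace transform of the M-asset basket spread payoff converges absolutely and ∫_{ℝ^M} e^{−Σ_m u_m x_m}·(e^{x₁} − Σ_{m=2}^M e^{x_m} − K)⁺ dx = K^{1−Σ_m u_m} · Γ(Σ_{m=1}^M u_m − 1) · ∏_{m=2}^M Γ(−u_m) / Γ(u₁ + 1). -/

import Mathlib

open MeasureTheory

theorem Complex.ofReal_exp_cpow (r : ℝ) (z : ℂ) :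
    ((Real.exp r : ℝ) : ℂ) ^ z = Complex.exp (r * z) := by
  rw [Complex.cpow_def_of_ne_zero (by exact_mod_cast (Real.exp_pos r).ne'),
    ← Complex.ofReal_log (Real.exp_pos r).le, Real.log_exp]

theorem image_exp_div_add_exp {K : ℝ} (hK : 0 < K) :
    (fun y : ℝ => Real.exp y / (K + Real.exp y)) '' Set.univ = Set.Ioo 0 1 := by
  ext t
  constructor
  · rintro ⟨y, -, rfl⟩
    have := Real.exp_pos y
    exact ⟨by positivity, by rw [div_lt_one (by positivity)]; linarith⟩
  · rintro ⟨h0, h1⟩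
    have h2 : 0 < 1 - t := by linarith
    refine ⟨Real.log (K * t / (1 - t)), trivial, ?_⟩
    simp only
    rw [Real.exp_log (by positivity)]
    field_simp
    ring

theorem injective_exp_div_add_exp {K : ℝ} (hK : 0 < K) :
    Function.Injective (fun y : ℝ => Real.exp y / (K + Real.exp y)) := by
  intro x y h
  have hx := Real.exp_pos x
  have hy := Real.exp_pos y
  simp only at h
  rw [div_eq_div_iff (by positivity) (by positivity)] at h
  exact Real.exp_injective (mul_left_cancel₀ hK.ne' (by linarith))

/-- The Beta integral of the second kind, in exponential coordinates. -/
theorem integrable_and_integral_exp_mul_add_exp_cpow {K : ℝ} (hK : 0 < K) {a s : ℂ}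
    (ha : 0 < a.re) (has : a.re < s.re) :
    Integrable (fun y : ℝ => Complex.exp (a * y) * ((K + Real.exp y : ℝ) : ℂ) ^ (-s)) ∧
    ∫ y : ℝ, Complex.exp (a * y) * ((K + Real.exp y : ℝ) : ℂ) ^ (-s) =
      (K : ℂ) ^ (a - s) * (Complex.Gamma a * Complex.Gamma (s - a) / Complex.Gamma s) := by
  have hsa : 0 < (s - a).re := by simpa using has
  set φ : ℝ → ℝ := fun y => Real.exp y / (K + Real.exp y)
  set φ' : ℝ → ℝ := fun y => K * Real.exp y / (K + Real.exp y) ^ 2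
  set g : ℝ → ℂ := fun t => (t : ℂ) ^ (a - 1) * (1 - (t : ℂ)) ^ (s - a - 1)
  have hd : ∀ y ∈ Set.univ, HasDerivWithinAt φ (φ' y) Set.univ y := by
    intro y _
    have hy := Real.exp_pos y
    have := (Real.hasDerivAt_exp y).div ((Real.hasDerivAt_exp y).const_add K) (by positivity)
    convert! this.hasDerivWithinAt using 1
    simp only [φ']
    ring
  have hinj : Set.InjOn φ Set.univ := (injective_exp_div_add_exp hK).injOn
  have hK0 : (K : ℂ) ≠ 0 := by exact_mod_cast hK.ne'
  have hg : ∀ y, |φ' y| • g (φ y) =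
      (K : ℂ) ^ (s - a) * (Complex.exp (a * y) * ((K + Real.exp y : ℝ) : ℂ) ^ (-s)) := by
    intro y
    have hy := Real.exp_pos y
    obtain ⟨k, rfl⟩ : ∃ k, K = Real.exp k := ⟨_, (Real.exp_log hK).symm⟩
    obtain ⟨L, hL⟩ : ∃ L, Real.exp k + Real.exp y = Real.exp L :=
      ⟨_, (Real.exp_log (by positivity)).symm⟩
    have h1 : φ y = Real.exp (y - L) := by simp only [φ, hL, Real.exp_sub]
    have h2 : (1 : ℂ) - (φ y : ℂ) = (Real.exp (k - L) : ℝ) := by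
      norm_cast
      rw [h1, Real.exp_sub, Real.exp_sub]
      field_simp
      linarith
    have h3 : |φ' y| = Real.exp (k + y - L - L) := by
      rw [abs_of_nonneg (by positivity)]
      simp only [φ', hL, Real.exp_sub, Real.exp_add]
      field_simp
    simp only [g]
    rw [h2, h3, h1, hL, Complex.real_smul]
    rw [Complex.ofReal_exp_cpow, Complex.ofReal_exp_cpow, Complex.ofReal_exp_cpow,
      Complex.ofReal_exp_cpow, Complex.ofReal_exp, ← Complex.exp_add, ← Complex.exp_add,
      ← Complex.exp_add, ← Complex.exp_add]
    congr 1
    push_cast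
    ring
  have hcancel : (K : ℂ) ^ (a - s) * (K : ℂ) ^ (s - a) = 1 := by
    rw [← Complex.cpow_add _ _ hK0]; simp
  have hfun : (fun y : ℝ => Complex.exp (a * y) * ((K + Real.exp y : ℝ) : ℂ) ^ (-s)) =
      fun y => (K : ℂ) ^ (a - s) * (|φ' y| • g (φ y)) := by
    funext y
    rw [hg, ← mul_assoc, hcancel, one_mul]
  have hIoo : IntegrableOn g (Set.Ioo 0 1) :=
    (intervalIntegrable_iff_integrableOn_Ioo_of_le zero_le_one).1
      (Complex.betaIntegral_convergent ha hsa)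
  have hbeta : ∫ t in Set.Ioo 0 1, g t =
      Complex.Gamma a * Complex.Gamma (s - a) / Complex.Gamma s := by
    rw [Complex.Gamma_mul_Gamma_eq_betaIntegral ha hsa, add_sub_cancel,
      mul_div_cancel_left₀ _ (Complex.Gamma_ne_zero_of_re_pos (ha.trans has)),
      Complex.betaIntegral, intervalIntegral.integral_of_le zero_le_one, integral_Ioc_eq_integral_Ioo]
  rw [hfun]
  constructor
  · refine Integrable.const_mul ?_ _
    rw [← integrableOn_univ,
      ← integrableOn_image_iff_integrableOn_abs_deriv_smul MeasurableSet.univ hd hinj,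
      image_exp_div_add_exp hK]
    exact hIoo
  · rw [integral_const_mul, ← hbeta, ← image_exp_div_add_exp hK,
      integral_image_eq_integral_abs_deriv_smul MeasurableSet.univ hd hinj, setIntegral_univ]

/-- The transform of a call payoff in one asset. -/
theorem integrable_and_integral_exp_mul_call {L : ℝ} (hL : 0 < L) {u : ℂ} (hu : 1 < u.re) :
    Integrable (fun x : ℝ => Complex.exp (-(u * x)) * (max (Real.exp x - L) 0 : ℝ)) ∧
    ∫ x : ℝ, Complex.exp (-(u * x)) * (max (Real.exp x - L) 0 : ℝ) =
      (L : ℂ) ^ (-(u - 1)) * (u * (u - 1))⁻¹ := by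
  have hfun : (fun x : ℝ => Complex.exp (-(u * x)) * (max (Real.exp x - L) 0 : ℝ)) =
      (Set.Ioi (Real.log L)).indicator
        (fun x : ℝ => Complex.exp ((1 - u) * x) - L * Complex.exp (-u * x)) := by
    funext x
    by_cases hx : Real.log L < x
    · have h1 : L < Real.exp x := (Real.log_lt_iff_lt_exp hL).1 hx
      rw [Set.indicator_of_mem (Set.mem_Ioi.2 hx), max_eq_left (by linarith),
        show (1 - u) * x = -(u * x) + x by ring, Complex.exp_add]
      push_cast
      ring_nf
    · have h1 : Real.exp x ≤ L := (Real.le_log_iff_exp_le hL).1 (not_lt.1 hx)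
      rw [Set.indicator_of_notMem (by simpa using hx), max_eq_right (by linarith)]
      simp
  have h1 : (1 - u).re < 0 := by simpa using hu
  have h2 : (-u).re < 0 := by simp; linarith
  have i1 := integrableOn_exp_mul_complex_Ioi h1 (Real.log L)
  have i2 := (integrableOn_exp_mul_complex_Ioi h2 (Real.log L)).const_mul (L : ℂ)
  rw [hfun]
  refine ⟨(integrable_indicator_iff measurableSet_Ioi).2 (i1.sub i2), ?_⟩
  rw [integral_indicator measurableSet_Ioi, integral_sub i1 i2, integral_const_mul,
    integral_exp_mul_complex_Ioi h1, integral_exp_mul_complex_Ioi h2]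
  have hu0 : u ≠ 0 := by rintro rfl; simp at h2
  have hu1 : u - 1 ≠ 0 := by intro h; rw [← neg_sub, h] at h1; simp at h1
  have hu1' : 1 - u ≠ 0 := by rw [← neg_sub]; exact neg_ne_zero.2 hu1
  obtain ⟨k, rfl⟩ : ∃ k, L = Real.exp k := ⟨_, (Real.exp_log hL).symm⟩
  rw [Real.log_exp, Complex.ofReal_exp_cpow, show (1 - u) * k = k + -u * k by ring,
    show (k : ℂ) * -(u - 1) = k + -u * k by ring, Complex.exp_add]
  push_cast
  field_simp
  ring

theorem integrable_and_integral_fin_succ {n : ℕ} {f : ℝ × (Fin n → ℝ) → ℂ}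
    (hf : Integrable f) :
    Integrable (fun x : Fin (n + 1) → ℝ => f (x 0, fun i => x i.succ)) ∧
    ∫ x : Fin (n + 1) → ℝ, f (x 0, fun i => x i.succ) = ∫ p, f p := by
  have hmp := volume_preserving_piFinSuccAbove (fun _ : Fin (n + 1) => ℝ) 0
  have hemb := (MeasurableEquiv.piFinSuccAbove (fun _ : Fin (n + 1) => ℝ) 0).measurableEmbedding
  exact ⟨(hmp.integrable_comp_emb hemb).2 hf, hmp.integral_comp hemb f⟩

theorem Complex.norm_exp_mul_cpow_eq {K : ℝ} (hK : 0 < K) (z s : ℂ) :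
    ((‖Complex.exp z * (K : ℂ) ^ s‖ : ℝ) : ℂ) =
      Complex.exp (z.re : ℂ) * (K : ℂ) ^ (s.re : ℂ) := by
  rw [norm_mul, Complex.norm_exp, Complex.norm_cpow_eq_rpow_re_of_pos hK, Complex.ofReal_mul,
    Complex.ofReal_exp, Complex.ofReal_cpow hK.le]

/-- A multivariate Beta integral (of inverted Dirichlet type), in exponential coordinates. -/
theorem integrable_and_integral_exp_sum_mul_add_sum_exp_cpow (n : ℕ) {K : ℝ} (hK : 0 < K)
    {a : Fin n → ℂ} {s : ℂ} (ha : ∀ i, 0 < (a i).re) (has : ∑ i, (a i).re < s.re) :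
    Integrable (fun x : Fin n → ℝ =>
      Complex.exp (∑ i, a i * x i) * ((K + ∑ i, Real.exp (x i) : ℝ) : ℂ) ^ (-s)) ∧
    ∫ x : Fin n → ℝ, Complex.exp (∑ i, a i * x i) *
        ((K + ∑ i, Real.exp (x i) : ℝ) : ℂ) ^ (-s) =
      (K : ℂ) ^ (∑ i, a i - s) *
        ((∏ i, Complex.Gamma (a i)) * Complex.Gamma (s - ∑ i, a i) / Complex.Gamma s) := by
  induction n generalizing K s with
  | zero =>
    have hs : Complex.Gamma s ≠ 0 := Complex.Gamma_ne_zero_of_re_pos (by simpa using has)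
    refine ⟨Integrable.of_finite, ?_⟩
    simp [hs, measureReal_def, volume_pi]
  | succ n ih =>
    have has' : ∑ i : Fin n, (a i.succ).re < s.re := by
      rw [Fin.sum_univ_succ] at has
      linarith [ha 0]
    have hre : (s - ∑ i : Fin n, a i.succ).re = s.re - ∑ i : Fin n, (a i.succ).re := by simp
    have hpos : ∀ (y : ℝ) (x : Fin n → ℝ), 0 < K + Real.exp y + ∑ i, Real.exp (x i) := by
      intro y x; positivity
    have inner : ∀ {b : Fin (n + 1) → ℂ} {t : ℂ}, (∀ i, 0 < (b i).re) →
        (∑ i : Fin n, (b i.succ).re < t.re) → ∀ y : ℝ,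
        Integrable (fun x : Fin n → ℝ => Complex.exp (b 0 * y + ∑ i, b i.succ * x i) *
          ((K + Real.exp y + ∑ i, Real.exp (x i) : ℝ) : ℂ) ^ (-t)) ∧
        ∫ x : Fin n → ℝ, Complex.exp (b 0 * y + ∑ i, b i.succ * x i) *
          ((K + Real.exp y + ∑ i, Real.exp (x i) : ℝ) : ℂ) ^ (-t) =
        Complex.exp (b 0 * y) * ((K + Real.exp y : ℝ) : ℂ) ^ (-(t - ∑ i : Fin n, b i.succ)) *
          ((∏ i : Fin n, Complex.Gamma (b i.succ)) *
            Complex.Gamma (t - ∑ i : Fin n, b i.succ) / Complex.Gamma t) := by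
      intro b t hb hbt y
      have hKy : 0 < K + Real.exp y := by positivity
      obtain ⟨h1, h2⟩ := ih hKy (a := fun i => b i.succ) (fun i => hb i.succ) hbt
      simp only [Complex.exp_add, mul_assoc]
      refine ⟨h1.const_mul _, ?_⟩
      rw [integral_const_mul, h2, neg_sub]
    set f : ℝ × (Fin n → ℝ) → ℂ := fun p =>
      Complex.exp (a 0 * p.1 + ∑ i : Fin n, a i.succ * p.2 i) *
        ((K + Real.exp p.1 + ∑ i, Real.exp (p.2 i) : ℝ) : ℂ) ^ (-s) with hf
    have hfc : Continuous f := by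
      refine Continuous.mul (by fun_prop) (Continuous.cpow (by fun_prop) continuous_const ?_)
      intro p
      exact Complex.ofReal_mem_slitPlane.2 (hpos _ _)
    have hfi : Integrable f := by
      refine (integrable_prod_iff hfc.aestronglyMeasurable).2
        ⟨.of_forall fun y => (inner ha has' y).1, ?_⟩
      have houter := ((integrable_and_integral_exp_mul_add_exp_cpow hK
        (a := ((a 0).re : ℂ)) (s := ((s.re : ℂ) - ∑ i : Fin n, ((a i.succ).re : ℂ)))
        (by simpa using ha 0) (by
          rw [Fin.sum_univ_succ] at has
          simp
          linarith)).1.mul_const ((∏ i : Fin n, Complex.Gamma ((a i.succ).re : ℂ)) *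
            Complex.Gamma ((s.re : ℂ) - ∑ i : Fin n, ((a i.succ).re : ℂ)) /
              Complex.Gamma (s.re : ℂ)))
      refine houter.re.congr (.of_forall fun y => ?_)
      have := (inner (b := fun i => ((a i).re : ℂ)) (t := (s.re : ℂ)) (by simpa using ha)
        (by simpa using has') y).2
      simp only at this ⊢
      rw [← this]
      apply Complex.ofReal_injective
      rw [← integral_complex_ofReal]
      have h3 : ∀ x, ((‖f (y, x)‖ : ℝ) : ℂ) =
        Complex.exp (((a 0).re : ℂ) * y + ∑ i : Fin n, ((a i.succ).re : ℂ) * x i) *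
          ((K + Real.exp y + ∑ i, Real.exp (x i) : ℝ) : ℂ) ^ (-(s.re : ℂ)) := by
        intro x
        rw [hf, Complex.norm_exp_mul_cpow_eq (hpos _ _)]
        simp
      rw [← integral_congr_ae (.of_forall h3), integral_complex_ofReal]
      simp
    obtain ⟨h1, h2⟩ := integrable_and_integral_fin_succ hfi
    have hfun : (fun x : Fin (n + 1) → ℝ => Complex.exp (∑ i, a i * x i) *
        ((K + ∑ i, Real.exp (x i) : ℝ) : ℂ) ^ (-s)) =
        fun x => f (x 0, fun i => x i.succ) := by
      funext x
      simp only [hf, Fin.sum_univ_succ, add_assoc]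
    rw [hfun]
    refine ⟨h1, ?_⟩
    rw [h2, Measure.volume_eq_prod, integral_prod _ hfi]
    simp only [hf, (inner ha has' _).2]
    rw [integral_mul_const, (integrable_and_integral_exp_mul_add_exp_cpow hK (ha 0) (by
          rw [Fin.sum_univ_succ] at has
          rw [hre]
          linarith)).2, Fin.sum_univ_succ, Fin.prod_univ_succ]
    have hG : Complex.Gamma (s - ∑ i : Fin n, a i.succ) ≠ 0 :=
      Complex.Gamma_ne_zero_of_re_pos (by rw [hre]; linarith)
    rw [show a 0 - (s - ∑ i : Fin n, a i.succ) = a 0 + ∑ i : Fin n, a i.succ - s by ring,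
      show s - ∑ i : Fin n, a i.succ - a 0 = s - (a 0 + ∑ i : Fin n, a i.succ) by ring]
    field_simp

theorem Fin.erase_zero_univ_eq_map_succ (n : ℕ) :
    Finset.univ.erase (0 : Fin (n + 1)) = Finset.univ.map (Fin.succEmb n) := by
  ext i
  cases i using Fin.cases <;> simp

/-- **Bilateral Laplace transform of the `M`-asset basket spread payoff.** For
`M ≥ 2`, `K > 0`, and `u ∈ ℂ^M` with `Re(u_m) < 0` for `m ≠ 0` and `Σ_m Re(u_m) > 1`,
the transform converges absolutely and
`∫_{ℝ^M} e^{−Σ u_m x_m} (e^{x₀} − Σ_{m≠0} e^{x_m} − K)⁺ dx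
  = K^{1−Σu} Γ(Σu − 1) ∏_{m≠0} Γ(−u_m) / Γ(u₀ + 1)`. -/
theorem laplace_transform_basket_spread (M : ℕ) (hM : 2 ≤ M)
    (K : ℝ) (hK : 0 < K) (u : Fin M → ℂ)
    (hre : ∀ m : Fin M, m ≠ ⟨0, by omega⟩ → (u m).re < 0)
    (hsum : 1 < ∑ m, (u m).re) :
    Integrable (fun x : Fin M → ℝ =>
      Complex.exp (-∑ m, u m * x m) *
        (max (Real.exp (x ⟨0, by omega⟩)
            - (∑ m ∈ Finset.univ.erase (⟨0, by omega⟩ : Fin M), Real.exp (x m)) - K) 0 : ℝ)) ∧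
    ∫ x : Fin M → ℝ,
        Complex.exp (-∑ m, u m * x m) *
          (max (Real.exp (x ⟨0, by omega⟩)
              - (∑ m ∈ Finset.univ.erase (⟨0, by omega⟩ : Fin M), Real.exp (x m)) - K) 0 : ℝ)
      = (K : ℂ) ^ (1 - ∑ m, u m) * Complex.Gamma ((∑ m, u m) - 1)
          * (∏ m ∈ Finset.univ.erase (⟨0, by omega⟩ : Fin M), Complex.Gamma (-u m))
          / Complex.Gamma (u ⟨0, by omega⟩ + 1) := by
  obtain ⟨n, rfl⟩ : ∃ n, M = n + 1 := ⟨M - 1, by omega⟩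
  simp only [Fin.mk_zero, Fin.erase_zero_univ_eq_map_succ, Finset.sum_map, Finset.prod_map,
    Fin.coe_succEmb, Fin.sum_univ_succ] at hre hsum ⊢
  have hneg : ∀ i : Fin n, 0 < (-u i.succ).re := fun i => by
    simpa using hre i.succ (Fin.succ_ne_zero i)
  have htail : ∑ i : Fin n, (-u i.succ).re < (u 0).re - 1 := by
    simp only [Complex.neg_re, Finset.sum_neg_distrib]
    linarith
  have hu0 : 1 < (u 0).re := by
    have := Finset.sum_nonneg fun i (_ : i ∈ Finset.univ) => (hneg i).le
    linarith
  have hpos : ∀ x : Fin n → ℝ, 0 < K + ∑ i, Real.exp (x i) := fun x => by positivity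
  set f : ℝ × (Fin n → ℝ) → ℂ := fun p =>
    Complex.exp (-(u 0 * p.1 + ∑ i : Fin n, u i.succ * p.2 i)) *
      (max (Real.exp p.1 - ∑ i, Real.exp (p.2 i) - K) 0 : ℝ) with hf
  have inner : ∀ {v : Fin (n + 1) → ℂ}, 1 < (v 0).re → ∀ x : Fin n → ℝ,
      Integrable (fun y : ℝ => Complex.exp (-(v 0 * y + ∑ i : Fin n, v i.succ * x i)) *
        (max (Real.exp y - ∑ i, Real.exp (x i) - K) 0 : ℝ)) ∧
      ∫ y : ℝ, Complex.exp (-(v 0 * y + ∑ i : Fin n, v i.succ * x i)) *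
        (max (Real.exp y - ∑ i, Real.exp (x i) - K) 0 : ℝ) =
      Complex.exp (∑ i : Fin n, -v i.succ * x i) *
        ((K + ∑ i, Real.exp (x i) : ℝ) : ℂ) ^ (-(v 0 - 1)) * (v 0 * (v 0 - 1))⁻¹ := by
    intro v hv x
    obtain ⟨h1, h2⟩ := integrable_and_integral_exp_mul_call (hpos x) hv
    have hfun : (fun y : ℝ => Complex.exp (-(v 0 * y + ∑ i : Fin n, v i.succ * x i)) *
        (max (Real.exp y - ∑ i, Real.exp (x i) - K) 0 : ℝ)) = fun y : ℝ =>
        Complex.exp (∑ i : Fin n, -v i.succ * x i) * (Complex.exp (-(v 0 * y)) *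
          (max (Real.exp y - (K + ∑ i, Real.exp (x i))) 0 : ℝ)) := by
      funext y
      rw [← mul_assoc, ← Complex.exp_add, sub_sub, add_comm K, neg_add, add_comm (-(v 0 * y : ℂ))]
      simp [Finset.sum_neg_distrib]
    rw [hfun, integral_const_mul, h2, mul_assoc]
    exact ⟨h1.const_mul _, rfl⟩
  have hfc : Continuous f := by fun_prop
  have hfi : Integrable f := by
    refine (integrable_prod_iff' hfc.aestronglyMeasurable).2
      ⟨.of_forall fun x => (inner hu0 x).1, ?_⟩
    have houter := (integrable_and_integral_exp_sum_mul_add_sum_exp_cpow n hK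
      (a := fun i => -((u i.succ).re : ℂ)) (s := ((u 0).re : ℂ) - 1)
      (by simpa using hneg) (by simpa using htail)).1.mul_const
        (((u 0).re : ℂ) * (((u 0).re : ℂ) - 1))⁻¹
    refine houter.re.congr (.of_forall fun x => ?_)
    have := (inner (v := fun i => ((u i).re : ℂ)) (by simpa using hu0) x).2
    simp only at this ⊢
    rw [← this]
    have h3 : ∀ y : ℝ, ((‖f (y, x)‖ : ℝ) : ℂ) =
        Complex.exp (-(((u 0).re : ℂ) * y + ∑ i : Fin n, ((u i.succ).re : ℂ) * x i)) *
          (max (Real.exp y - ∑ i, Real.exp (x i) - K) 0 : ℝ) := by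
      intro y
      rw [hf, norm_mul, Complex.norm_exp, Complex.norm_real, Real.norm_of_nonneg (le_max_right _ _),
        Complex.ofReal_mul, Complex.ofReal_exp]
      simp
    rw [← integral_congr_ae (.of_forall h3), integral_complex_ofReal]
    simp
  obtain ⟨h1, h2⟩ := integrable_and_integral_fin_succ hfi
  refine ⟨h1, h2.trans ?_⟩
  rw [Measure.volume_eq_prod, integral_prod_symm _ hfi]
  simp only [hf, (inner hu0 _).2]
  rw [integral_mul_const, (integrable_and_integral_exp_sum_mul_add_sum_exp_cpow n hK
    (a := fun i => -u i.succ) (s := u 0 - 1) hneg (by simpa using htail)).2]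
  have hu0' : u 0 ≠ 0 := by intro h; rw [h] at hu0; norm_num at hu0
  have hu1 : u 0 - 1 ≠ 0 := by
    intro h; rw [sub_eq_zero.1 h] at hu0; norm_num at hu0
  have hG : Complex.Gamma (u 0 + 1) = u 0 * (u 0 - 1) * Complex.Gamma (u 0 - 1) := by
    have := Complex.Gamma_add_one (u 0 - 1) hu1
    rw [sub_add_cancel] at this
    rw [Complex.Gamma_add_one _ hu0', this, mul_assoc]
  have hG1 : Complex.Gamma (u 0 - 1) ≠ 0 :=
    Complex.Gamma_ne_zero_of_re_pos (by simpa using hu0)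
  rw [hG, Finset.sum_neg_distrib,
    show -∑ i : Fin n, u i.succ - (u 0 - 1) = 1 - (u 0 + ∑ i : Fin n, u i.succ) by ring,
    show u 0 - 1 - -∑ i : Fin n, u i.succ = u 0 + ∑ i : Fin n, u i.succ - 1 by ring]
  field_simp
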